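/- arXiv:2010.09167 — 3 statements merged into one kernel-verified Lean document; each statement's English description precedes it below -/
import Mathlib

section
/- Let L be an integral domain of characteristic 0 with quotient field Q(L), r a positive integer, f_1(z),…,f_r(z) ∈ (1/z)·L[[1/z]], n⃗ = (n_1,…,n_r) ∈ ℕ^r, N := ∑_{i=1}^r n_i, and M an integer with M ≥ N. Then there exists a family of polynomials (P_0(z), P_1(z), …, P_r(z)) ∈ L[z]^{r+1}∖{0} such that: (i) deg P_0(z) ≤ M, and (ii) ord_∞(P_0(z)·f_j(z) − P_j(z)) ≥ n_j + 1 for every 1 ≤ j ≤ r. -/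
open Polynomial

/-- The formal Laurent series (in the variable `w = 1/z`, so the Hahn-exponent `t : ℤ`
records the coefficient of `z^{-t}`) attached to a polynomial `P(z)`. -/
noncomputable def polyToLaurent (L : Type) [CommRing L] (P : Polynomial L) : LaurentSeries L :=
  ∑ j ∈ Finset.range (P.natDegree + 1), HahnSeries.single (-(j : ℤ)) (P.coeff j)

/-- The formal Laurent series `∑_{k≥0} c_k z^{-(k+1)}` attached to a coefficient
sequence `c : ℕ → L`. -/
noncomputable def tailToLaurent (L : Type) [CommRing L] (c : ℕ → L) : LaurentSeries L :=
  HahnSeries.single (1 : ℤ) (1 : L) * HahnSeries.ofPowerSeries ℤ L (PowerSeries.mk c)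

theorem coeff_polyToLaurent_neg_natCast {L : Type} [CommRing L] (P : Polynomial L) (k : ℕ) :
    (polyToLaurent L P).coeff (-(k : ℤ)) = P.coeff k := by
  simp only [polyToLaurent, HahnSeries.coeff_sum, HahnSeries.coeff_single, neg_inj, Nat.cast_inj,
    Finset.sum_ite_eq, Finset.mem_range]
  split_ifs with h
  · rfl
  · exact (coeff_eq_zero_of_natDegree_lt (by omega)).symm

theorem coeff_polyToLaurent_of_pos {L : Type} [CommRing L] (P : Polynomial L) {t : ℤ}
    (ht : 0 < t) : (polyToLaurent L P).coeff t = 0 := by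
  simp only [polyToLaurent, HahnSeries.coeff_sum]
  exact Finset.sum_eq_zero fun j _ => HahnSeries.coeff_single_of_ne (by omega)

theorem coeff_single_mul_eq_coeff_sub {L : Type} [CommRing L] (s t : ℤ) (a : L)
    (x : LaurentSeries L) : (HahnSeries.single s a * x).coeff t = a * x.coeff (t - s) := by
  rw [← HahnSeries.coeff_single_mul_add, sub_add_cancel]

theorem coeff_tailToLaurent_natCast_add_one {L : Type} [CommRing L] (c : ℕ → L) (k : ℕ) :
    (tailToLaurent L c).coeff ((k : ℤ) + 1) = c k := by
  rw [tailToLaurent, coeff_single_mul_eq_coeff_sub, add_sub_cancel_right, one_mul]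
  simp

theorem coeff_tailToLaurent_of_nonpos {L : Type} [CommRing L] (c : ℕ → L) {t : ℤ} (ht : t ≤ 0) :
    (tailToLaurent L c).coeff t = 0 := by
  rw [tailToLaurent, coeff_single_mul_eq_coeff_sub, one_mul, HahnSeries.ofPowerSeries_apply]
  refine HahnSeries.embDomain_of_notMem_range ?_
  rintro ⟨k, hk⟩
  have : (k : ℤ) = t - 1 := hk
  omega

theorem coeff_polyToLaurent_mul {L : Type} [CommRing L] (P : Polynomial L) {M : ℕ}
    (hP : P.natDegree ≤ M) (x : LaurentSeries L) (t : ℤ) :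
    (polyToLaurent L P * x).coeff t =
      ∑ j ∈ Finset.range (M + 1), P.coeff j * x.coeff (t + j) := by
  simp only [polyToLaurent, Finset.sum_mul, HahnSeries.coeff_sum, coeff_single_mul_eq_coeff_sub,
    sub_neg_eq_add]
  refine Finset.sum_subset (Finset.range_subset_range.2 (Nat.succ_le_succ hP)) fun j _ hj => ?_
  rw [coeff_eq_zero_of_natDegree_lt (by rw [Finset.mem_range] at hj; omega), zero_mul]

theorem exists_polyToLaurent_coeff_eq_of_nonpos {L : Type} [CommRing L] (P : Polynomial L)
    (c : ℕ → L) :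
    ∃ Q : Polynomial L, ∀ t : ℤ, t ≤ 0 →
      (polyToLaurent L Q).coeff t = (polyToLaurent L P * tailToLaurent L c).coeff t := by
  refine ⟨∑ k ∈ Finset.range P.natDegree,
    monomial k ((polyToLaurent L P * tailToLaurent L c).coeff (-(k : ℤ))), fun t ht => ?_⟩
  obtain ⟨k, rfl⟩ : ∃ k : ℕ, t = -(k : ℤ) := ⟨t.natAbs, by omega⟩
  rw [coeff_polyToLaurent_neg_natCast]
  simp only [finsetSum_coeff, coeff_monomial, Finset.sum_ite_eq', Finset.mem_range]
  split_ifs with h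
  · rfl
  · rw [coeff_polyToLaurent_mul P le_rfl]
    refine (Finset.sum_eq_zero fun j hj => ?_).symm
    rw [Finset.mem_range] at hj
    rw [coeff_tailToLaurent_of_nonpos c (by omega), mul_zero]

theorem exists_ne_zero_mulVec_eq_zero {L ι κ : Type} [CommRing L] [Nontrivial L]
    [Fintype ι] [Fintype κ] (A : Matrix ι κ L) (h : Fintype.card ι < Fintype.card κ) :
    ∃ v : κ → L, v ≠ 0 ∧ A.mulVec v = 0 := by
  by_contra! H
  refine h.not_ge (card_le_of_injective L A.mulVecLin ?_)
  rw [← LinearMap.ker_eq_bot, LinearMap.ker_eq_bot']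
  intro v hv
  by_contra hne
  exact H v hne hv

theorem stmt3 (L : Type) [CommRing L] [IsDomain L] [CharZero L]
    (r : ℕ) (hr : 0 < r) (f : Fin r → ℕ → L) (n : Fin r → ℕ) (M : ℕ)
    (hM : (∑ i, n i) ≤ M) :
    ∃ P : Fin (r + 1) → Polynomial L,
      P ≠ 0 ∧
      (P 0).degree ≤ (M : ℕ) ∧
      ∀ j : Fin r, ∀ t : ℤ, t ≤ (n j : ℤ) →
        (polyToLaurent L (P 0) * tailToLaurent L (f j)
          - polyToLaurent L (P j.succ)).coeff t = 0 := by
  classical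
  obtain ⟨v, hv, hAv⟩ := exists_ne_zero_mulVec_eq_zero
    (Matrix.of fun (p : Σ i, Fin (n i)) (j : Fin (M + 1)) => f p.1 (p.2 + j))
    (by simpa using Nat.lt_succ_of_le hM)
  set P := Polynomial.ofFn (M + 1) v
  have hcoeff : ∀ j : Fin (M + 1), P.coeff j = v j := fun j =>
    ofFn_coeff_eq_val_of_lt v j.2
  have hdeg : P.natDegree ≤ M := Nat.lt_succ_iff.mp (ofFn_natDegree_lt (by omega) v)
  choose Q hQ using fun i => exists_polyToLaurent_coeff_eq_of_nonpos P (f i)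
  refine ⟨Fin.cons P Q, fun h => hv ?_, degree_le_of_natDegree_le hdeg, fun i t ht => ?_⟩
  · have hP : P = 0 := congrFun h 0
    ext j
    rw [← hcoeff, hP, coeff_zero, Pi.zero_apply]
  · rw [Fin.cons_zero, Fin.cons_succ, HahnSeries.coeff_sub]
    rcases le_or_gt t 0 with ht0 | ht0
    · rw [hQ i t ht0, sub_self]
    · obtain ⟨k, rfl⟩ : ∃ k : ℕ, t = (k : ℤ) + 1 := ⟨(t - 1).toNat, by omega⟩
      rw [coeff_polyToLaurent_of_pos _ ht0, sub_zero, coeff_polyToLaurent_mul P hdeg,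
        Finset.sum_range]
      have hrow := congrFun hAv ⟨i, ⟨k, by omega⟩⟩
      simp only [Matrix.mulVec, dotProduct, Matrix.of_apply, Pi.zero_apply] at hrow
      rw [← hrow]
      refine Finset.sum_congr rfl fun j _ => ?_
      rw [hcoeff, add_right_comm, ← Nat.cast_add, coeff_tailToLaurent_natCast_add_one, mul_comm]
end

section
/- Let r, m be positive integers, α_1,…,α_m nonzero pairwise distinct algebraic numbers, K = ℚ(α_1,…,α_m), and x ∈ ℚ not a negative integer. For a positive integer n, let Δ_n(z) be the determinant of the (rm+1)×(rm+1) matrix whose (l+1)-st column, for 0 ≤ l ≤ rm, is the vector (P_{n,l}(z), P_{n,l,1,1}(z), …, P_{n,l,1,r}(z), …, P_{n,l,m,1}(z), …, P_{n,l,m,r}(z)). Then for every positive integer n, Δ_n(z) is a nonzero constant: Δ_n(z) ∈ K∖{0}. -/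
open Polynomial

noncomputable def SPoly (L : Type) [CommRing L] [Algebra ℚ L] (x : ℚ) (n : ℕ)
    (a : Polynomial L) : Polynomial L :=
  a.sum fun k c =>
    Polynomial.C (c * algebraMap ℚ L ((ascPochhammer ℚ n).eval ((k : ℚ) + x + 1) / n.factorial)) *
      Polynomial.X ^ k

noncomputable def PadeP (L : Type) [CommRing L] [Algebra ℚ L] (x : ℚ) (r m n : ℕ)
    (α : Fin m → L) (l : ℕ) : Polynomial L :=
  (SPoly L x n)^[r] (Polynomial.X ^ l * ∏ i, (Polynomial.X - Polynomial.C (α i)) ^ (r * n))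

noncomputable def PadeQ (L : Type) [CommRing L] [Algebra ℚ L] (x : ℚ) (r m n : ℕ)
    (α : Fin m → L) (l : ℕ) (i : Fin m) (s : ℕ) : Polynomial L :=
  let P := PadeP L x r m n α l
  ∑ a ∈ Finset.range (P.natDegree + 1),
    Polynomial.C (∑ b ∈ Finset.range (P.natDegree + 1),
        P.coeff (a + b + 1) * (α i) ^ (b + 1) * algebraMap ℚ L (1 / (((b : ℚ) + x + 1) ^ s))) *
      Polynomial.X ^ a

/-- The `(rm+1) × (rm+1)` matrix whose `l`-th column is
`(P_{n,l}, P_{n,l,1,1}, …, P_{n,l,1,r}, …, P_{n,l,m,1}, …, P_{n,l,m,r})`. -/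
noncomputable def padeMatrix (K : Type) [Field K] [CharZero K] (x : ℚ) (r m n : ℕ)
    (α : Fin m → K) : Matrix (Fin (r * m + 1)) (Fin (r * m + 1)) (Polynomial K) :=
  fun a l =>
    if ha : (a : ℕ) = 0 then PadeP K x r m n α l
    else
      PadeQ K x r m n α l
        ⟨((a : ℕ) - 1) / r, Nat.div_lt_of_lt_mul (by have := a.isLt; omega)⟩
        (((a : ℕ) - 1) % r + 1)

section EulerOperator

variable {K : Type*} [Field K]

theorem natDegree_X_mul_derivative_iterate_le (u : K[X]) (D e : ℕ) (hu : u.natDegree ≤ D) :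
    ((fun p : K[X] => X * derivative p)^[e] u).natDegree ≤ D := by
  induction e with
  | zero => simpa
  | succ e ih =>
    rw [Function.iterate_succ_apply']
    refine natDegree_le_iff_coeff_eq_zero.2 fun j hj => ?_
    cases j with
    | zero => simp
    | succ j =>
      rw [coeff_X_mul, coeff_derivative, coeff_eq_zero_of_natDegree_lt (ih.trans_lt hj), zero_mul]

theorem coeff_X_mul_derivative_iterate (u : K[X]) (e j : ℕ) :
    ((fun p : K[X] => X * derivative p)^[e] u).coeff j = (j : K) ^ e * u.coeff j := by
  induction e with
  | zero => simp
  | succ e ih =>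
    rw [Function.iterate_succ_apply']
    cases j with
    | zero => simp
    | succ j =>
      rw [coeff_X_mul, coeff_derivative, ih]
      push_cast
      ring

theorem X_sub_C_pow_dvd_X_mul_derivative_iterate {u : K[X]} {a : K} {M : ℕ}
    (h : (X - C a) ^ M ∣ u) (e : ℕ) :
    (X - C a) ^ (M - e) ∣ (fun p : K[X] => X * derivative p)^[e] u := by
  induction e with
  | zero => simpa
  | succ e ih =>
    rw [Function.iterate_succ_apply']
    exact (pow_sub_one_dvd_derivative_of_pow_dvd ih).mul_left _

theorem sum_coeff_mul_eval_mul_pow_eq_zero {u g : K[X]} {a : K} {M D : ℕ}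
    (hu : u.natDegree ≤ D) (h : (X - C a) ^ M ∣ u) (hg : g.natDegree < M) :
    ∑ j ∈ Finset.range (D + 1), u.coeff j * g.eval (j : K) * a ^ j = 0 := by
  simp_rw [eval_eq_sum_range, Finset.mul_sum, Finset.sum_mul]
  rw [Finset.sum_comm]
  refine Finset.sum_eq_zero fun e he => ?_
  have hroot : ((fun p : K[X] => X * derivative p)^[e] u).eval a = 0 := by
    refine dvd_iff_isRoot.1 ((dvd_pow_self _ ?_).trans
      (X_sub_C_pow_dvd_X_mul_derivative_iterate h e))
    have := Finset.mem_range.1 he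
    omega
  rw [eval_eq_sum_range'
    (Nat.lt_succ_of_le (natDegree_X_mul_derivative_iterate_le u D e hu))] at hroot
  simp_rw [coeff_X_mul_derivative_iterate] at hroot
  rw [← mul_zero (g.coeff e), ← hroot, Finset.mul_sum]
  exact Finset.sum_congr rfl fun j _ => by ring

theorem X_sub_C_pow_dvd_of_sum_coeff_mul_eval_mul_pow_eq_zero [CharZero K]
    {u : K[X]} {a : K} (ha : a ≠ 0) {M D : ℕ} (hu : u.natDegree ≤ D)
    (h : ∀ g : K[X], g.natDegree < M →
      ∑ j ∈ Finset.range (D + 1), u.coeff j * g.eval (j : K) * a ^ j = 0) :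
    (X - C a) ^ M ∣ u := by
  rw [X_sub_C_pow_dvd_iff, X_pow_dvd_iff]
  intro e he
  rw [← taylor_apply, taylor_coeff, hasseDeriv_apply,
    sum_over_range' _ (by simp) (D + 1) (Nat.lt_succ_of_le hu), eval_finsetSum]
  have hfac : (e.factorial : K) ≠ 0 := Nat.cast_ne_zero.2 e.factorial_ne_zero
  have key := h (descPochhammer K e) (by rwa [descPochhammer_natDegree])
  have : ∀ j : ℕ, eval a (monomial (j - e) ((j.choose e : K) * u.coeff j)) =
      (e.factorial : K)⁻¹ * (a ^ e)⁻¹ *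
        (u.coeff j * (descPochhammer K e).eval (j : K) * a ^ j) := by
    intro j
    rw [descPochhammer_eval_eq_descFactorial, eval_monomial]
    rcases lt_or_ge j e with hj | hj
    · simp [Nat.choose_eq_zero_of_lt hj, Nat.descFactorial_eq_zero_iff_lt.2 hj]
    · obtain ⟨d, rfl⟩ := Nat.exists_eq_add_of_le hj
      rw [Nat.descFactorial_eq_factorial_mul_choose, Nat.add_sub_cancel_left, pow_add]
      push_cast
      field_simp
  simp_rw [this]
  rw [← Finset.mul_sum, key, mul_zero]

end EulerOperator

section PoleNumerator

variable {K : Type*} [Field K]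

/-- The polynomial `∏_{i < n} (X + ξ + i) ^ r / (X + ξ + k) ^ s`, for `k < n` and `s ≤ r`. -/
noncomputable def poleNumerator (ξ : K) (r n k s : ℕ) : K[X] :=
  (∏ i ∈ (Finset.range n).erase k, (X + C (ξ + i)) ^ r) * (X + C (ξ + k)) ^ (r - s)

theorem natDegree_poleNumerator_lt (ξ : K) {r n k s : ℕ} (hk : k < n) (hs : 0 < s) (hsr : s ≤ r) :
    (poleNumerator ξ r n k s).natDegree < r * n := by
  have h1 : (∏ i ∈ (Finset.range n).erase k, (X + C (ξ + (i : K))) ^ r).natDegree ≤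
      (n - 1) * r := by
    refine (natDegree_prod_le _ _).trans ?_
    simp only [natDegree_pow, natDegree_X_add_C, mul_one, Finset.sum_const,
      Finset.card_erase_of_mem (Finset.mem_range.2 hk), Finset.card_range, smul_eq_mul, le_refl]
  have h2 : ((X + C (ξ + (k : K))) ^ (r - s)).natDegree = r - s := by
    rw [natDegree_pow, natDegree_X_add_C, mul_one]
  refine (natDegree_mul_le.trans (add_le_add h1 h2.le)).trans_lt ?_
  obtain ⟨n, rfl⟩ : ∃ n', n = n' + 1 := ⟨n - 1, by omega⟩
  rw [Nat.add_sub_cancel, mul_add, mul_comm]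
  omega

theorem eval_poleNumerator (ξ : K) (hξ : ∀ j : ℕ, ξ + j ≠ 0) {r n k s : ℕ} (hk : k < n)
    (hsr : s ≤ r) (j : ℕ) :
    (poleNumerator ξ r n k s).eval (j : K) =
      (∏ i ∈ Finset.range n, (ξ + j + i)) ^ r / (ξ + ((j + k : ℕ) : K)) ^ s := by
  rw [eq_div_iff (pow_ne_zero _ (hξ _)), ← Finset.prod_pow,
    ← Finset.prod_erase_mul _ _ (Finset.mem_range.2 hk), poleNumerator]
  simp only [eval_mul, eval_prod, eval_pow, eval_add, eval_X, eval_C]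
  have h3 : (ξ + (j : K) + k) ^ r = ((j : K) + (ξ + k)) ^ (r - s) * (ξ + ((j + k : ℕ) : K)) ^ s := by
    push_cast
    rw [show (j : K) + (ξ + k) = ξ + (j + k) by ring, ← pow_add, Nat.sub_add_cancel hsr, add_assoc]
  rw [h3, mul_assoc]
  congr 1
  exact Finset.prod_congr rfl fun i _ => by ring

theorem exists_eq_mul_prod_add_sum_poleNumerator [CharZero K] (ξ : K) (r n : ℕ) (g : K[X]) :
    ∃ (q : K[X]) (c : ℕ → Fin r → K),
      g = q * ∏ k ∈ Finset.range n, (X + C (ξ + k)) ^ r +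
        ∑ k ∈ Finset.range n, ∑ s : Fin r, C (c k s) * poleNumerator ξ r n k (r - s) := by
  have hcop : Set.Pairwise (Finset.range n : Set ℕ)
      fun i j => IsCoprime (X + C (ξ + (i : K))) (X + C (ξ + (j : K))) := by
    intro i _ j _ hij
    have h : -(ξ + (i : K)) ≠ -(ξ + (j : K)) := by simpa using hij
    have h' := isCoprime_X_sub_C_of_isUnit_sub (sub_ne_zero.2 h).isUnit
    rwa [C_neg, C_neg, sub_neg_eq_add, sub_neg_eq_add] at h'
  have hmonic : ∀ i ∈ Finset.range n, (X + C (ξ + (i : K))).Monic := fun i _ => monic_X_add_C _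
  obtain ⟨q, c, hc, hgc⟩ :=
    eq_quo_mul_prod_pow_add_sum_rem_mul_prod_pow g hmonic hcop (fun _ => r)
  refine ⟨q, fun k s => (c k s).coeff 0, ?_⟩
  suffices h : ∑ k ∈ Finset.range n, ∑ s : Fin r, c k s * (X + C (ξ + (k : K))) ^ (s : ℕ) *
      ∏ i ∈ (Finset.range n).erase k, (X + C (ξ + (i : K))) ^ r =
      ∑ k ∈ Finset.range n, ∑ s : Fin r,
        C ((c k s).coeff 0) * poleNumerator ξ r n k (r - s) by
    rw [← h]
    exact hgc
  refine Finset.sum_congr rfl fun k hk => Finset.sum_congr rfl fun s _ => ?_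
  have hcs := hc k hk s
  rw [degree_X_add_C] at hcs
  rw [← eq_C_of_degree_le_zero (Nat.WithBot.lt_one_iff_le_zero.1 hcs), poleNumerator,
    Nat.sub_sub_self s.2.le, mul_assoc, mul_comm (_ ^ (s : ℕ))]

theorem exists_eq_sum_poleNumerator [CharZero K] (ξ : K) {r n : ℕ} {g : K[X]}
    (hg : g.natDegree < r * n) :
    ∃ c : ℕ → Fin r → K,
      g = ∑ k ∈ Finset.range n, ∑ s : Fin r, C (c k s) * poleNumerator ξ r n k (r - s) := by
  obtain ⟨q, c, hgc⟩ := exists_eq_mul_prod_add_sum_poleNumerator ξ r n g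
  refine ⟨c, ?_⟩
  have hWm : (∏ k ∈ Finset.range n, (X + C (ξ + (k : K))) ^ r).Monic :=
    monic_prod_of_monic _ _ fun k _ => (monic_X_add_C _).pow r
  have hWd : (∏ k ∈ Finset.range n, (X + C (ξ + (k : K))) ^ r).natDegree = r * n := by
    rw [natDegree_prod_of_monic _ _ fun k _ => (monic_X_add_C _).pow r]
    simp only [natDegree_pow, natDegree_X_add_C, mul_one, Finset.sum_const, Finset.card_range,
      smul_eq_mul, mul_comm]
  have hq : q = 0 := by
    by_contra hq
    have h1 : r * n ≤ (q * ∏ k ∈ Finset.range n, (X + C (ξ + (k : K))) ^ r).natDegree := by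
      rw [mul_comm q, hWm.natDegree_mul' hq, hWd]
      omega
    have h2 : q * ∏ k ∈ Finset.range n, (X + C (ξ + (k : K))) ^ r =
        g - ∑ k ∈ Finset.range n, ∑ s : Fin r,
          C (c k s) * poleNumerator ξ r n k (r - s) := eq_sub_of_add_eq hgc.symm
    have h3 : (∑ k ∈ Finset.range n, ∑ s : Fin r,
        C (c k s) * poleNumerator ξ r n k (r - s)).natDegree ≤ r * n - 1 := by
      refine natDegree_sum_le_of_forall_le _ _ fun k hk =>
        natDegree_sum_le_of_forall_le _ _ fun s _ => (natDegree_C_mul_le _ _).trans ?_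
      have := natDegree_poleNumerator_lt ξ (r := r) (Finset.mem_range.1 hk)
        (Nat.sub_pos_of_lt s.2) (Nat.sub_le r s)
      omega
    have h4 := natDegree_sub_le_of_le (Nat.le_sub_one_of_lt hg) h3
    rw [← h2, max_self] at h4
    omega
  rw [hq, zero_mul, zero_add] at hgc
  exact hgc

end PoleNumerator

section Moments

variable {K : Type*} [Field K]

/-- The functional `t ^ b ↦ ν b` applied to `t ^ k * P`, for `P` of degree at most `D`. -/
def moment (ν : ℕ → K) (D k : ℕ) (P : K[X]) : K :=
  ∑ j ∈ Finset.range (D + 1), P.coeff j * ν (j + k)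

/-- The moments `a ^ (b + 1) / (ξ + b) ^ s` of the functional `φ_{a, ξ - 1, s}`. -/
def lerchMoment (ξ a : K) (s b : ℕ) : K := a ^ (b + 1) / (ξ + b) ^ s

theorem moment_sum_C_mul {ι : Type*} (t : Finset ι) (v : ι → K) (P : ι → K[X]) (ν : ℕ → K)
    (D k : ℕ) :
    moment ν D k (∑ l ∈ t, C (v l) * P l) = ∑ l ∈ t, v l * moment ν D k (P l) := by
  simp only [moment, finsetSum_coeff, coeff_C_mul, Finset.sum_mul, Finset.mul_sum]
  rw [Finset.sum_comm]
  exact Finset.sum_congr rfl fun l _ => Finset.sum_congr rfl fun j _ => by ring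

theorem moment_lerchMoment_of_coeff {P u : K[X]} {ξ a β : K} (hξ : ∀ j : ℕ, ξ + j ≠ 0)
    {r n k s D : ℕ} (hk : k < n) (hsr : s ≤ r)
    (hP : ∀ j, P.coeff j = β * (∏ i ∈ Finset.range n, (ξ + j + i)) ^ r * u.coeff j) :
    moment (lerchMoment ξ a s) D k P = β * a ^ (k + 1) *
      ∑ j ∈ Finset.range (D + 1),
        u.coeff j * (poleNumerator ξ r n k s).eval (j : K) * a ^ j := by
  rw [moment, Finset.mul_sum]
  refine Finset.sum_congr rfl fun j _ => ?_
  rw [hP, eval_poleNumerator ξ hξ hk hsr, lerchMoment]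
  ring

theorem moment_lerchMoment_eq_zero {P u : K[X]} {ξ a β : K} (hξ : ∀ j : ℕ, ξ + j ≠ 0)
    {r n k s D : ℕ} (hk : k < n) (hs : 0 < s) (hsr : s ≤ r) (hu : u.natDegree ≤ D)
    (hP : ∀ j, P.coeff j = β * (∏ i ∈ Finset.range n, (ξ + j + i)) ^ r * u.coeff j)
    (hdvd : (X - C a) ^ (r * n) ∣ u) :
    moment (lerchMoment ξ a s) D k P = 0 := by
  rw [moment_lerchMoment_of_coeff hξ hk hsr hP,
    sum_coeff_mul_eval_mul_pow_eq_zero hu hdvd (natDegree_poleNumerator_lt ξ hk hs hsr), mul_zero]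

theorem eq_zero_of_moment_lerchMoment_eq_zero [CharZero K] {ξ : K} (hξ : ∀ j : ℕ, ξ + j ≠ 0)
    {r m n D : ℕ} {α : Fin m → K} (hα : ∀ i, α i ≠ 0) (hinj : Function.Injective α)
    {P : K[X]} (hPD : P.natDegree ≤ D) (hdeg : ∀ j, m * (r * n) ≤ j → P.coeff j = 0)
    (hP : ∀ i, ∀ k < n, ∀ s, 0 < s → s ≤ r → moment (lerchMoment ξ (α i) s) D k P = 0) :
    P = 0 := by
  have hprod : ∀ j : ℕ, (∏ i ∈ Finset.range n, (ξ + (j : K) + i)) ^ r ≠ 0 := fun j =>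
    pow_ne_zero _ (Finset.prod_ne_zero_iff.2 fun i _ => by
      rw [add_assoc, ← Nat.cast_add]
      exact hξ (j + i))
  set q : K[X] := ∑ j ∈ Finset.range (D + 1),
    monomial j (P.coeff j / (∏ i ∈ Finset.range n, (ξ + (j : K) + i)) ^ r) with hq
  have hqc : ∀ j, q.coeff j = P.coeff j / (∏ i ∈ Finset.range n, (ξ + (j : K) + i)) ^ r := by
    intro j
    rw [hq, finsetSum_coeff]
    simp only [coeff_monomial]
    rw [Finset.sum_ite_eq']
    split_ifs with h
    · rfl
    · rw [coeff_eq_zero_of_natDegree_lt (by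
        have : ¬ j < D + 1 := fun h' => h (Finset.mem_range.2 h')
        omega), zero_div]
  have hPq : ∀ j, P.coeff j = 1 * (∏ i ∈ Finset.range n, (ξ + (j : K) + i)) ^ r * q.coeff j := by
    intro j
    rw [hqc, one_mul, mul_div_cancel₀ _ (hprod j)]
  have hqD : q.natDegree ≤ D := natDegree_le_iff_coeff_eq_zero.2 fun j hj => by
    rw [hqc, coeff_eq_zero_of_natDegree_lt (hPD.trans_lt hj), zero_div]
  have hdvd : ∀ i, (X - C (α i)) ^ (r * n) ∣ q := by
    intro i
    refine X_sub_C_pow_dvd_of_sum_coeff_mul_eval_mul_pow_eq_zero (hα i) hqD fun g hg => ?_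
    obtain ⟨c, rfl⟩ := exists_eq_sum_poleNumerator ξ hg
    have hpole : ∀ k ∈ Finset.range n, ∀ s : Fin r, ∑ j ∈ Finset.range (D + 1),
        q.coeff j * (poleNumerator ξ r n k (r - s)).eval (j : K) * α i ^ j = 0 := by
      intro k hk s
      have h := hP i k (Finset.mem_range.1 hk) (r - s) (Nat.sub_pos_of_lt s.2) (Nat.sub_le r s)
      rw [moment_lerchMoment_of_coeff hξ (Finset.mem_range.1 hk) (Nat.sub_le r s) hPq] at h
      exact (mul_eq_zero.1 h).resolve_left (mul_ne_zero one_ne_zero (pow_ne_zero _ (hα i)))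
    simp only [eval_finsetSum, eval_mul, eval_C, Finset.mul_sum, Finset.sum_mul]
    rw [Finset.sum_comm]
    refine Finset.sum_eq_zero fun k hk => ?_
    rw [Finset.sum_comm]
    refine Finset.sum_eq_zero fun s _ => ?_
    rw [← mul_zero (c k s), ← hpole k hk s, Finset.mul_sum]
    exact Finset.sum_congr rfl fun j _ => by ring
  have hq0 : q = 0 := by
    by_contra hne
    have hall : ∏ i, (X - C (α i)) ^ (r * n) ∣ q :=
      Finset.prod_dvd_of_coprime
        (fun i _ j _ hij => (pairwise_coprime_X_sub_C hinj hij).pow) fun i _ => hdvd i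
    have h1 := natDegree_le_of_dvd hall hne
    rw [natDegree_prod_of_monic _ _ fun i _ => (monic_X_sub_C _).pow _] at h1
    simp only [natDegree_pow, natDegree_X_sub_C, mul_one, Finset.sum_const, Finset.card_univ,
      Fintype.card_fin, smul_eq_mul] at h1
    have h2 := hqc q.natDegree
    rw [hdeg _ h1, zero_div] at h2
    exact hne (leadingCoeff_eq_zero.1 h2)
  ext j
  rw [hPq, hq0]
  simp

end Moments

section Remainder

variable {K : Type*} [Field K]

/-- The truncation `∑_{b < N} ν b * X ^ (N - 1 - b)` of `X ^ N * ∑_b ν b / X ^ (b + 1)`. -/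
noncomputable def truncatedStieltjes (ν : ℕ → K) (N : ℕ) : K[X] :=
  ∑ b ∈ Finset.range N, C (ν b) * X ^ (N - 1 - b)

theorem coeff_truncatedStieltjes_mul (ν : ℕ → K) (N c : ℕ) (P : K[X]) :
    (truncatedStieltjes ν N * P).coeff c =
      ∑ b ∈ Finset.range N, ν b * if N - 1 - b ≤ c then P.coeff (c - (N - 1 - b)) else 0 := by
  rw [truncatedStieltjes, Finset.sum_mul, finsetSum_coeff]
  refine Finset.sum_congr rfl fun b _ => ?_
  rw [mul_assoc, coeff_C_mul, coeff_X_pow_mul']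

theorem coeff_X_pow_mul_sub_truncatedStieltjes_mul {ν : ℕ → K} {P Q : K[X]} {D n : ℕ}
    (hP : P.natDegree ≤ D) {k : ℕ} (hk : k ≤ n) :
    (X ^ (D + n + 1) * Q - truncatedStieltjes ν (D + n + 1) * P).coeff (D + n - k) =
      -moment ν D k P := by
  rw [coeff_sub, coeff_X_pow_mul', if_neg (by omega), zero_sub, coeff_truncatedStieltjes_mul,
    show D + n + 1 = k + (D + 1 + (n - k)) by omega, Finset.sum_range_add,
    Finset.sum_eq_zero, zero_add, Finset.sum_range_add _ (D + 1) (n - k), moment]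
  · rw [Finset.sum_eq_zero (s := Finset.range (n - k)), add_zero]
    · congr 1
      refine Finset.sum_congr rfl fun j hj => ?_
      have := Finset.mem_range.1 hj
      rw [if_pos (by omega), show D + n - k - (k + (D + 1 + (n - k)) - 1 - (k + j)) = j by omega,
        mul_comm, add_comm k j]
    · intro j hj
      have := Finset.mem_range.1 hj
      rw [coeff_eq_zero_of_natDegree_lt (by omega)]
      simp
  · intro b hb
    have := Finset.mem_range.1 hb
    rw [if_neg (by omega), mul_zero]

theorem natDegree_X_pow_mul_sub_truncatedStieltjes_mul_le {ν : ℕ → K} {P Q : K[X]} {D n : ℕ}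
    (hP : P.natDegree ≤ D)
    (hQ : ∀ c, Q.coeff c = ∑ b ∈ Finset.range (D + n + 1), P.coeff (c + b + 1) * ν b)
    (hmom : ∀ k < n, moment ν D k P = 0) :
    (X ^ (D + n + 1) * Q - truncatedStieltjes ν (D + n + 1) * P).natDegree ≤ D := by
  refine natDegree_le_iff_coeff_eq_zero.2 fun c hc => ?_
  rcases le_or_gt c (D + n) with h | h
  · obtain ⟨k, rfl, hk⟩ : ∃ k, c = D + n - k ∧ k < n := ⟨D + n - c, by omega, by omega⟩
    rw [coeff_X_pow_mul_sub_truncatedStieltjes_mul hP hk.le, hmom k hk, neg_zero]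
  · obtain ⟨c, rfl⟩ := Nat.exists_eq_add_of_le' h
    rw [coeff_sub, coeff_truncatedStieltjes_mul, Nat.succ_eq_add_one, coeff_X_pow_mul, hQ,
      sub_eq_zero]
    refine Finset.sum_congr rfl fun b hb => ?_
    have := Finset.mem_range.1 hb
    rw [if_pos (by omega), mul_comm]
    congr 2
    omega

end Remainder

section Determinant

variable {K : Type*} [CommRing K] {ι : Type*} [Fintype ι] [DecidableEq ι]

theorem natDegree_det_le_of_forall_natDegree_le (B : Matrix ι ι K[X]) (D : ℕ)
    (hB : ∀ i j, (B i j).natDegree ≤ D) : B.det.natDegree ≤ Fintype.card ι * D := by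
  rw [Matrix.det_apply']
  refine natDegree_sum_le_of_forall_le _ _ fun σ _ => natDegree_mul_le.trans ?_
  rw [natDegree_intCast, zero_add]
  refine (natDegree_prod_le _ _).trans ((Finset.sum_le_sum fun i _ => hB (σ i) i).trans ?_)
  simp

theorem coeff_det_of_forall_natDegree_le (B : Matrix ι ι K[X]) (D : ℕ)
    (hB : ∀ i j, (B i j).natDegree ≤ D) :
    B.det.coeff (Fintype.card ι * D) = (B.map fun p => p.coeff D).det := by
  rw [Matrix.det_apply', Matrix.det_apply', finsetSum_coeff]
  refine Finset.sum_congr rfl fun σ _ => ?_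
  rw [coeff_intCast_mul, ← Finset.card_univ,
    coeff_prod_of_natDegree_le _ _ _ fun i _ => hB (σ i) i]
  rfl

end Determinant

section Pade

theorem ascPochhammer_eval_eq_prod (y : ℚ) (n : ℕ) :
    (ascPochhammer ℚ n).eval y = ∏ i ∈ Finset.range n, (y + i) := by
  induction n with
  | zero => simp
  | succ n ih => rw [ascPochhammer_succ_eval, ih, Finset.prod_range_succ]

variable {K : Type} [Field K]

theorem natDegree_X_pow_mul_prod_le (r m n : ℕ) (α : Fin m → K) (l : ℕ) (hl : l ≤ r * m) :
    (X ^ l * ∏ i, (X - C (α i)) ^ (r * n)).natDegree ≤ m * (r * (n + 1)) := by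
  refine natDegree_mul_le.trans ?_
  rw [natDegree_prod_of_monic _ _ fun i _ => (monic_X_sub_C _).pow _]
  simp only [natDegree_pow, natDegree_X_sub_C, mul_one, Finset.sum_const, Finset.card_univ,
    Fintype.card_fin, smul_eq_mul, natDegree_X]
  nlinarith

variable [CharZero K]

theorem coeff_SPoly (x : ℚ) (n : ℕ) (p : K[X]) (j : ℕ) :
    (SPoly K x n p).coeff j = (n.factorial : K)⁻¹ *
      (∏ i ∈ Finset.range n, (algebraMap ℚ K (x + 1) + j + i)) * p.coeff j := by
  rw [SPoly, sum_def, finsetSum_coeff]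
  simp only [coeff_C_mul_X_pow]
  rw [Finset.sum_ite_eq, ascPochhammer_eval_eq_prod]
  split_ifs with h
  · rw [map_div₀, map_prod, map_natCast, div_eq_mul_inv, mul_comm (p.coeff j), mul_comm (∏ _ ∈ _, _)]
    congr 2
    refine Finset.prod_congr rfl fun i _ => ?_
    simp only [map_add, map_natCast, map_one]
    ring
  · rw [notMem_support_iff.1 h, mul_zero]

theorem coeff_SPoly_iterate (x : ℚ) (n r : ℕ) (p : K[X]) (j : ℕ) :
    ((SPoly K x n)^[r] p).coeff j = ((n.factorial : K)⁻¹) ^ r *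
      (∏ i ∈ Finset.range n, (algebraMap ℚ K (x + 1) + j + i)) ^ r * p.coeff j := by
  induction r with
  | zero => simp
  | succ r ih =>
    rw [Function.iterate_succ_apply', coeff_SPoly, ih]
    ring

theorem natDegree_PadeP_le (x : ℚ) (r m n : ℕ) (α : Fin m → K) (l : ℕ) (hl : l ≤ r * m) :
    (PadeP K x r m n α l).natDegree ≤ m * (r * (n + 1)) := by
  refine natDegree_le_iff_coeff_eq_zero.2 fun j hj => ?_
  rw [PadeP, coeff_SPoly_iterate, coeff_eq_zero_of_natDegree_lt
    ((natDegree_X_pow_mul_prod_le r m n α l hl).trans_lt hj), mul_zero]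

theorem coeff_PadeQ (x : ℚ) (r m n : ℕ) (α : Fin m → K) (l : ℕ) (i : Fin m) (s N : ℕ)
    (hN : (PadeP K x r m n α l).natDegree ≤ N) (c : ℕ) :
    (PadeQ K x r m n α l i s).coeff c = ∑ b ∈ Finset.range (N + 1),
      (PadeP K x r m n α l).coeff (c + b + 1) *
        lerchMoment (algebraMap ℚ K (x + 1)) (α i) s b := by
  have hterm : ∀ b : ℕ, (PadeP K x r m n α l).coeff (c + b + 1) * (α i) ^ (b + 1) *
      algebraMap ℚ K (1 / (((b : ℚ) + x + 1) ^ s)) =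
      (PadeP K x r m n α l).coeff (c + b + 1) *
        lerchMoment (algebraMap ℚ K (x + 1)) (α i) s b := by
    intro b
    rw [lerchMoment, show (b : ℚ) + x + 1 = x + 1 + b by ring, map_div₀, map_one, map_pow,
      map_add _ (x + 1), map_natCast]
    ring
  rw [PadeQ, finsetSum_coeff]
  simp only [coeff_C_mul_X_pow]
  rw [Finset.sum_ite_eq]
  simp only [hterm]
  set P := PadeP K x r m n α l
  have hzero : ∀ b, P.natDegree < c + b + 1 → P.coeff (c + b + 1) *
      lerchMoment (algebraMap ℚ K (x + 1)) (α i) s b = 0 := fun b hb => by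
    rw [coeff_eq_zero_of_natDegree_lt hb, zero_mul]
  split_ifs with h
  · refine Finset.sum_subset (Finset.range_mono (by omega)) fun b _ hb => hzero b ?_
    rw [Finset.mem_range] at hb
    omega
  · rw [Finset.mem_range] at h
    exact (Finset.sum_eq_zero fun b _ => hzero b (by omega)).symm

theorem moment_PadeP_eq_zero {x : ℚ} (hξ : ∀ j : ℕ, algebraMap ℚ K (x + 1) + j ≠ 0)
    (r m n : ℕ) (α : Fin m → K) (l : ℕ) (hl : l ≤ r * m) (i : Fin m) {k s : ℕ} (hk : k < n)
    (hs : 0 < s) (hsr : s ≤ r) :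
    moment (lerchMoment (algebraMap ℚ K (x + 1)) (α i) s) (m * (r * (n + 1))) k
      (PadeP K x r m n α l) = 0 :=
  moment_lerchMoment_eq_zero hξ hk hs hsr (natDegree_X_pow_mul_prod_le r m n α l hl)
    (fun j => coeff_SPoly_iterate x n r _ j)
    ((Finset.dvd_prod_of_mem (fun i => (X - C (α i)) ^ (r * n)) (Finset.mem_univ i)).mul_left _)

theorem eq_zero_of_sum_C_mul_PadeP_eq_zero {x : ℚ}
    (hξ : ∀ j : ℕ, algebraMap ℚ K (x + 1) + j ≠ 0) (r m n : ℕ) (α : Fin m → K) {d : ℕ}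
    (v : Fin d → K) (hv : ∑ l, C (v l) * PadeP K x r m n α l = 0) : v = 0 := by
  have hW : (∏ i, (X - C (α i)) ^ (r * n)) ≠ 0 :=
    (monic_prod_of_monic _ _ fun i _ => (monic_X_sub_C _).pow _).ne_zero
  have hmul : (∑ l : Fin d, C (v l) * X ^ (l : ℕ)) * ∏ i, (X - C (α i)) ^ (r * n) = 0 := by
    ext j
    have hj := congrArg (fun p => p.coeff j) hv
    simp only [finsetSum_coeff, coeff_C_mul, PadeP, coeff_SPoly_iterate, coeff_zero] at hj
    have hne : ((n.factorial : K)⁻¹) ^ r *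
        (∏ i ∈ Finset.range n, (algebraMap ℚ K (x + 1) + j + i)) ^ r ≠ 0 := by
      refine mul_ne_zero (pow_ne_zero _ (inv_ne_zero (Nat.cast_ne_zero.2 n.factorial_ne_zero)))
        (pow_ne_zero _ (Finset.prod_ne_zero_iff.2 fun i _ => ?_))
      rw [add_assoc, ← Nat.cast_add]
      exact hξ (j + i)
    rw [Finset.sum_mul, finsetSum_coeff, coeff_zero]
    refine (mul_eq_zero.1 ?_).resolve_left hne
    rw [← hj, Finset.mul_sum]
    refine Finset.sum_congr rfl fun l _ => ?_
    rw [mul_assoc (C (v l)), coeff_C_mul]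
    ring
  have hsum := (mul_eq_zero.1 hmul).resolve_right hW
  funext l
  have hl := congrArg (fun p => p.coeff (l : ℕ)) hsum
  simp only [finsetSum_coeff, coeff_C_mul_X_pow, coeff_zero] at hl
  rw [Finset.sum_eq_single l (fun b _ hb => if_neg fun h => hb (Fin.ext h.symm)) (by simp)] at hl
  simpa using hl

end Pade

theorem stmt7 (r m : ℕ) (hr : 0 < r) (hm : 0 < m)
    (K : Type) [Field K] [CharZero K]
    (α : Fin m → K) (hα : ∀ i, α i ≠ 0) (hinj : Function.Injective α)
    (halg : ∀ i, IsAlgebraic ℚ (α i))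
    (hgen : IntermediateField.adjoin ℚ (Set.range α) = (⊤ : IntermediateField ℚ K))
    (x : ℚ) (hx : ∀ k : ℕ, x ≠ -(k + 1 : ℤ))
    (n : ℕ) (hn : 0 < n) :
    ∃ c : K, c ≠ 0 ∧ (padeMatrix K x r m n α).det = Polynomial.C c := by
  have hξ : ∀ j : ℕ, algebraMap ℚ K (x + 1) + j ≠ 0 := by
    intro j hj
    refine hx j ?_
    rw [← map_natCast (algebraMap ℚ K), ← map_add, map_eq_zero] at hj
    push_cast
    linarith
  set ξ := algebraMap ℚ K (x + 1) with hξdef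
  set D := m * (r * (n + 1)) with hD
  set N := D + n + 1 with hN
  set A := padeMatrix K x r m n α with hA
  have hlt : ∀ a : Fin (r * m + 1), (a : ℕ) ≠ 0 → ((a : ℕ) - 1) / r < m := fun a ha =>
    Nat.div_lt_of_lt_mul (by have := a.isLt; omega)
  let ν : Fin (r * m + 1) → ℕ → K := fun a =>
    if ha : (a : ℕ) = 0 then 0
    else lerchMoment ξ (α ⟨((a : ℕ) - 1) / r, hlt a ha⟩) (((a : ℕ) - 1) % r + 1)
  have hle : ∀ l : Fin (r * m + 1), (l : ℕ) ≤ r * m := fun l => Nat.le_of_lt_succ l.isLt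
  have hPdeg : ∀ l : Fin (r * m + 1), (PadeP K x r m n α l).natDegree ≤ D := fun l =>
    natDegree_PadeP_le x r m n α l (hle l)
  let B : Matrix (Fin (r * m + 1)) (Fin (r * m + 1)) K[X] := Matrix.of fun a l =>
    if (a : ℕ) = 0 then PadeP K x r m n α l
    else X ^ N * A a l - truncatedStieltjes (ν a) N * PadeP K x r m n α l
  have hBdeg : ∀ a l, (B a l).natDegree ≤ D := by
    intro a l
    simp only [B, Matrix.of_apply]
    split_ifs with ha
    · exact hPdeg l
    · have hs : ((a : ℕ) - 1) % r + 1 ≤ r := Nat.mod_lt _ hr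
      refine natDegree_X_pow_mul_sub_truncatedStieltjes_mul_le (hPdeg l) (fun c => ?_)
        fun k hk => ?_
      · simp only [hA, padeMatrix, ν, dif_neg ha]
        exact coeff_PadeQ x r m n α l _ _ _ ((hPdeg l).trans (Nat.le_add_right _ _)) c
      · simp only [ν, dif_neg ha]
        exact moment_PadeP_eq_zero hξ r m n α l (hle l) _ hk (Nat.succ_pos _) hs
  have hdet : X ^ (Fintype.card (Fin (r * m + 1)) * D) * A.det = B.det := by
    have h1 := Matrix.det_mul_column
      (fun a : Fin (r * m + 1) => if (a : ℕ) = 0 then (1 : K[X]) else X ^ N) A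
    rw [Fin.prod_univ_succ] at h1
    simp only [Fin.val_zero, if_true, one_mul, Fin.val_succ, Nat.succ_ne_zero, if_false,
      Finset.prod_const, Finset.card_univ, Fintype.card_fin] at h1
    rw [← pow_mul] at h1
    rw [Fintype.card_fin, show (r * m + 1) * D = N * (r * m) by rw [hN, hD]; ring, ← h1]
    refine Matrix.det_eq_of_forall_row_eq_smul_add_const
      (fun a => if (a : ℕ) = 0 then 0 else truncatedStieltjes (ν a) N) 0 (by simp) fun a l => ?_
    simp only [B, Matrix.of_apply, Fin.val_zero, if_true]
    split_ifs with ha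
    · simp [hA, padeMatrix, ha]
    · ring
  have hBnonsing : (B.map fun p => p.coeff D).det ≠ 0 := by
    intro h0
    obtain ⟨v, hv0, hv⟩ := Matrix.exists_mulVec_eq_zero_iff.2 h0
    refine hv0 (eq_zero_of_sum_C_mul_PadeP_eq_zero hξ r m n α v ?_)
    have hrow : ∀ a, ∑ l, v l * (B a l).coeff D = 0 := fun a => by
      have h := congrFun hv a
      simp only [Matrix.mulVec, dotProduct, Matrix.map_apply, Pi.zero_apply] at h
      rw [← h]
      exact Finset.sum_congr rfl fun l _ => mul_comm _ _
    have hPsum : (∑ l, C (v l) * PadeP K x r m n α l).natDegree ≤ D :=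
      natDegree_sum_le_of_forall_le _ _ fun l _ => (natDegree_C_mul_le _ _).trans (hPdeg l)
    refine eq_zero_of_moment_lerchMoment_eq_zero hξ (r := r) (n := n + 1) hα hinj hPsum
      (fun j hj => ?_) fun i k hk s hs hsr => ?_
    · rcases hj.eq_or_lt with rfl | hj
      · rw [finsetSum_coeff, ← hrow 0]
        simp [B, ← hD]
      · exact coeff_eq_zero_of_natDegree_lt (hPsum.trans_lt hj)
    · rw [moment_sum_C_mul]
      rcases (Nat.lt_succ_iff.1 hk).eq_or_lt with rfl | hk
      · obtain ⟨s, rfl⟩ : ∃ s', s = s' + 1 := ⟨s - 1, by omega⟩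
        have hrm : (i : ℕ) * r + s < r * m := by nlinarith [i.isLt]
        have h := hrow ⟨(i : ℕ) * r + s + 1, by omega⟩
        have hmod : ((i : ℕ) * r + s) % r = s := by
          rw [mul_comm, Nat.mul_add_mod, Nat.mod_eq_of_lt hsr]
        have hdiv : ((i : ℕ) * r + s) / r = i := by
          rw [mul_comm, Nat.mul_add_div hr, Nat.div_eq_of_lt hsr, add_zero]
        simp only [B, ν, Matrix.of_apply, Nat.succ_ne_zero, if_false, dif_neg, not_false_eq_true,
          Nat.add_sub_cancel, hmod, hdiv, Fin.eta] at h
        rw [← neg_eq_zero, ← h, ← Finset.sum_neg_distrib]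
        refine Finset.sum_congr rfl fun l _ => ?_
        have := coeff_X_pow_mul_sub_truncatedStieltjes_mul (n := k) (k := k)
          (ν := lerchMoment ξ (α i) (s + 1)) (Q := A ⟨(i : ℕ) * r + s + 1, by omega⟩ l)
          (hPdeg l) le_rfl
        rw [Nat.add_sub_cancel] at this
        rw [this, mul_neg]
      · exact Finset.sum_eq_zero fun l _ => by
          rw [moment_PadeP_eq_zero hξ r m n α l (hle l) i hk hs hsr, mul_zero]
  refine ⟨(B.map fun p => p.coeff D).det, hBnonsing, ?_⟩
  have hdeg := natDegree_det_le_of_forall_natDegree_le B D hBdeg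
  rw [← coeff_det_of_forall_natDegree_le B D hBdeg, ← hdet]
  ext c
  cases c with
  | zero => simp [coeff_X_pow_mul']
  | succ c =>
    rw [coeff_C_succ, ← coeff_X_pow_mul _ (Fintype.card (Fin (r * m + 1)) * D), hdet]
    exact coeff_eq_zero_of_natDegree_lt (by omega)
end

section
/- Let r, m be positive integers, α_1,…,α_m nonzero pairwise distinct algebraic numbers, K = ℚ(α_1,…,α_m), x ∈ ℚ not a negative integer, and n a positive integer. Let Θ_n be the determinant of the rm×rm matrix whose rows are indexed by pairs (i,s) with 1 ≤ i ≤ m, 1 ≤ s ≤ r and whose columns are indexed by 0 ≤ l ≤ rm−1, with entry φ_{α_i,x,s}(t^n·P_{n,l}(t)). Set A_{n,l}(t) := t^l·∏_{j=1}^m (t−α_j)^{rn}. Then Θ_n = (−1)^{r²mn} · det[(φ_{α_i,x,s}(t^n·A_{n,l}(t)))_{(i,s),l}], where the matrix on the right has the same row index (i,s) and column index 0 ≤ l ≤ rm−1. -/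
open Polynomial

noncomputable def phiPoly (L : Type) [CommRing L] [Algebra ℚ L] (α : L) (x : ℚ) (s : ℤ)
    (a : Polynomial L) : L :=
  a.sum fun k c => c * α ^ (k + 1) * algebraMap ℚ L (((k : ℚ) + x + 1) ^ (-s))

/-- `A_{n,l}(t) = t^l ∏ⱼ (t-αⱼ)^{rn}`. -/
noncomputable def PadeA (L : Type) [CommRing L] (r m n : ℕ) (α : Fin m → L) (l : ℕ) :
    Polynomial L :=
  Polynomial.X ^ l * ∏ j, (Polynomial.X - Polynomial.C (α j)) ^ (r * n)

lemma coeff_iterate_X_mul_derivative {R : Type*} [CommSemiring R] (A : R[X]) (j k : ℕ) :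
    ((fun p : R[X] => X * derivative p)^[j] A).coeff k = A.coeff k * (k : R) ^ j := by
  induction j with
  | zero => simp
  | succ j ih =>
    rw [Function.iterate_succ_apply']
    cases k with
    | zero => simp
    | succ k =>
      rw [coeff_X_mul, coeff_derivative, ih]
      push_cast
      ring

lemma dvd_iterate_X_mul_derivative {R : Type*} [CommRing R] {a : R} (j : ℕ) :
    ∀ {N : ℕ} {A : R[X]}, (X - C a) ^ (N + j) ∣ A →
      (X - C a) ^ N ∣ (fun p : R[X] => X * derivative p)^[j] A := by
  induction j with
  | zero => intro N A h; simpa using h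
  | succ j ih =>
    intro N A h
    rw [Function.iterate_succ_apply]
    refine ih (Dvd.dvd.mul_left ?_ X)
    obtain ⟨B, rfl⟩ := h
    rw [derivative_mul, derivative_X_sub_C_pow, ← add_assoc, Nat.add_sub_cancel]
    exact dvd_add ((Dvd.intro_left _ rfl).mul_right _)
      ((pow_dvd_pow _ (Nat.le_succ _)).mul_right _)

/-- If `a` is a root of `A` of order at least `N`, weighting the coefficients of `A` by a polynomial
of degree less than `N` in the exponent still gives an expression vanishing at `a`. -/
lemma sum_coeff_mul_pow_mul_eval_eq_zero {R : Type*} [CommRing R] {a : R} {N M : ℕ} {A w : R[X]}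
    (hA : (X - C a) ^ N ∣ A) (hw : w.natDegree < N) (hM : A.natDegree < M) :
    ∑ k ∈ Finset.range M, A.coeff k * a ^ k * w.eval (k : R) = 0 := by
  simp only [eval_eq_sum_range' hw, Finset.mul_sum]
  rw [Finset.sum_comm]
  refine Finset.sum_eq_zero fun j hj => ?_
  have hj' := Finset.mem_range.1 hj
  set B := (fun p : R[X] => X * derivative p)^[j] A with hB
  have hdvd : (X - C a) ^ (N - j) ∣ B :=
    dvd_iterate_X_mul_derivative j (by rwa [Nat.sub_add_cancel hj'.le])
  have hroot : B.eval a = 0 :=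
    dvd_iff_isRoot.1 ((dvd_pow_self _ (Nat.sub_ne_zero_of_lt hj')).trans hdvd)
  have hdeg : B.natDegree < M := by
    refine lt_of_le_of_lt (natDegree_le_iff_coeff_eq_zero.2 fun k hk => ?_) hM
    rw [hB, coeff_iterate_X_mul_derivative, coeff_eq_zero_of_natDegree_lt hk, zero_mul]
  rw [eval_eq_sum_range' hdeg] at hroot
  rw [← mul_zero (w.coeff j), ← hroot, Finset.mul_sum]
  refine Finset.sum_congr rfl fun k _ => ?_
  rw [hB, coeff_iterate_X_mul_derivative]
  ring

lemma natDegree_iterate_divX {R : Type*} [Semiring R] (q : R[X]) (s : ℕ) :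
    (divX^[s] q).natDegree = q.natDegree - s := by
  induction s with
  | zero => simp
  | succ s ih =>
    rw [Function.iterate_succ_apply', natDegree_divX_eq_natDegree_tsub_one, ih, Nat.sub_sub]

lemma eval_div_pow_eq_sum_add {F : Type*} [Field F] {y : F} (hy : y ≠ 0) (s : ℕ) :
    ∀ q : F[X], q.eval y / y ^ s =
      ∑ j ∈ Finset.range s, q.coeff j / y ^ (s - j) + (divX^[s] q).eval y := by
  induction s with
  | zero => simp
  | succ s ih =>
    intro q
    have hq : q.eval y = (divX q).eval y * y + q.coeff 0 := by
      conv_lhs => rw [← divX_mul_X_add q]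
      simp
    rw [Finset.sum_range_succ', Function.iterate_succ_apply, hq]
    have h := ih (divX q)
    simp only [coeff_divX] at h
    simp only [Nat.add_sub_add_right, Nat.sub_zero]
    rw [add_right_comm, ← h]
    field_simp
    ring

/-- The `r`-th power of the eigenvalue of `SPoly` on `X ^ (k - n)`, as a polynomial in
`k + x + 1`. -/
noncomputable def weightPoly (r n : ℕ) : ℚ[X] :=
  (C (1 / (n.factorial : ℚ)) * (ascPochhammer ℚ n).comp (X - C (n : ℚ))) ^ r

lemma eval_weightPoly (r n : ℕ) (y : ℚ) :
    (weightPoly r n).eval y = ((ascPochhammer ℚ n).eval (y - n) / n.factorial) ^ r := by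
  simp [weightPoly, eval_comp, div_eq_inv_mul]

lemma coeff_zero_weightPoly (r n : ℕ) : (weightPoly r n).coeff 0 = (-1) ^ (n * r) := by
  rw [coeff_zero_eq_eval_zero, eval_weightPoly, zero_sub, ascPochhammer_eval_neg_eq_descPochhammer,
    descPochhammer_eval_eq_descFactorial, Nat.descFactorial_self, mul_div_assoc,
    div_self (by exact_mod_cast n.factorial_ne_zero), mul_one, pow_mul]

lemma natDegree_weightPoly_le (r n : ℕ) : (weightPoly r n).natDegree ≤ r * n := by
  refine natDegree_pow_le.trans (Nat.mul_le_mul_left r ?_)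
  refine (natDegree_C_mul_le _ _).trans (natDegree_comp_le.trans ?_)
  rw [natDegree_X_sub_C, mul_one, ascPochhammer_natDegree]

lemma coeff_SPoly_s9 (L : Type) [CommRing L] [Algebra ℚ L] (x : ℚ) (n : ℕ) (a : L[X]) (k : ℕ) :
    (SPoly L x n a).coeff k =
      a.coeff k * algebraMap ℚ L ((ascPochhammer ℚ n).eval ((k : ℚ) + x + 1) / n.factorial) := by
  rw [SPoly, sum_def, finsetSum_coeff]
  simp only [coeff_C_mul_X_pow]
  rw [Finset.sum_ite_eq]
  split_ifs with h
  · rfl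
  · rw [notMem_support_iff.1 h, zero_mul]

lemma coeff_iterate_SPoly (L : Type) [CommRing L] [Algebra ℚ L] (x : ℚ) (n r : ℕ) (a : L[X])
    (k : ℕ) : ((SPoly L x n)^[r] a).coeff k = a.coeff k *
      algebraMap ℚ L (((ascPochhammer ℚ n).eval ((k : ℚ) + x + 1) / n.factorial) ^ r) := by
  induction r with
  | zero => simp
  | succ r ih =>
    rw [Function.iterate_succ_apply', coeff_SPoly_s9, ih, pow_succ, map_mul, mul_assoc]

lemma coeff_X_pow_mul_PadeP (L : Type) [CommRing L] [Algebra ℚ L] (x : ℚ) (r m n : ℕ)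
    (α : Fin m → L) (l k : ℕ) :
    (X ^ n * PadeP L x r m n α l).coeff k = (X ^ n * PadeA L r m n α l).coeff k *
      algebraMap ℚ L ((weightPoly r n).eval ((k : ℚ) + x + 1)) := by
  rw [coeff_X_pow_mul', coeff_X_pow_mul']
  split_ifs with h
  · rw [PadeP, PadeA, coeff_iterate_SPoly, eval_weightPoly, Nat.cast_sub h,
      show (k : ℚ) - n + x + 1 = k + x + 1 - n by ring]
  · rw [zero_mul]

lemma phiPoly_eq_sum_range (L : Type) [CommRing L] [Algebra ℚ L] (α : L) (x : ℚ) (s : ℕ)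
    {a : L[X]} {M : ℕ} (hM : a.natDegree < M) :
    phiPoly L α x s a = ∑ k ∈ Finset.range M,
      a.coeff k * α ^ (k + 1) * algebraMap ℚ L (1 / ((k : ℚ) + x + 1) ^ s) := by
  rw [phiPoly, sum_over_range' _ (by simp) M hM]
  simp only [zpow_neg, zpow_natCast, one_div]

/-- Modulo the terms killed by the high order vanishing at `α i`, the operator `SPoly` acts on the
functionals `phiPoly` by a triangular matrix. -/
lemma phiPoly_PadeP {K : Type} [Field K] [CharZero K] {x : ℚ} (hx : ∀ k : ℕ, (k : ℚ) + x + 1 ≠ 0)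
    {r m n : ℕ} (hr : 0 < r) (hn : 0 < n) (α : Fin m → K) (l : ℕ) (i : Fin m) {s : ℕ}
    (hs : 0 < s) :
    phiPoly K (α i) x s (X ^ n * PadeP K x r m n α l) =
      ∑ j ∈ Finset.range s, algebraMap ℚ K ((weightPoly r n).coeff j) *
        phiPoly K (α i) x (s - j : ℕ) (X ^ n * PadeA K r m n α l) := by
  set A := X ^ n * PadeA K r m n α l with hA
  set M := max A.natDegree (X ^ n * PadeP K x r m n α l).natDegree + 1 with hM
  have hAM : A.natDegree < M := by omega
  have hPM : (X ^ n * PadeP K x r m n α l).natDegree < M := by omega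
  have hdvd : (X - C (α i)) ^ (r * n) ∣ A :=
    Dvd.dvd.mul_left (Dvd.dvd.mul_left
      (Finset.dvd_prod_of_mem (fun j => (X - C (α j)) ^ (r * n)) (Finset.mem_univ i)) _) _
  set v := divX^[s] (weightPoly r n) with hv
  set w := (v.map (algebraMap ℚ K)).comp (X + C (algebraMap ℚ K (x + 1))) with hw
  have hwdeg : w.natDegree < r * n := by
    have h1 : w.natDegree ≤ v.natDegree := by
      refine natDegree_comp_le.trans ?_
      rw [natDegree_X_add_C, mul_one, natDegree_map]
    rw [hv, natDegree_iterate_divX] at h1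
    have := natDegree_weightPoly_le r n
    have := Nat.mul_pos hr hn
    omega
  have hweval (k : ℕ) : w.eval (k : K) = algebraMap ℚ K (v.eval ((k : ℚ) + x + 1)) := by
    rw [hw, eval_comp, ← eval_map_apply]
    simp [add_assoc]
  have hzero := sum_coeff_mul_pow_mul_eval_eq_zero hdvd hwdeg hAM
  rw [phiPoly_eq_sum_range K _ _ _ hPM]
  simp only [phiPoly_eq_sum_range K _ _ _ hAM, Finset.mul_sum]
  conv_rhs => rw [Finset.sum_comm, ← add_zero (Finset.sum _ _), ← mul_zero (α i), ← hzero]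
  rw [Finset.mul_sum, ← Finset.sum_add_distrib]
  refine Finset.sum_congr rfl fun k _ => ?_
  have hk := congrArg (algebraMap ℚ K) (eval_div_pow_eq_sum_add (hx k) s (weightPoly r n))
  rw [coeff_X_pow_mul_PadeP, ← hA, hweval]
  calc _ = A.coeff k * α i ^ (k + 1) *
        algebraMap ℚ K ((weightPoly r n).eval ((k : ℚ) + x + 1) / ((k : ℚ) + x + 1) ^ s) := by
        rw [div_eq_mul_one_div ((weightPoly r n).eval _), map_mul]; ring
    _ = _ := by
        rw [hk, map_add, map_sum, mul_add, Finset.mul_sum]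
        congr 1
        · refine Finset.sum_congr rfl fun j _ => ?_
          rw [div_eq_mul_one_div, map_mul]; ring
        · ring

theorem stmt9 (r m : ℕ) (hr : 0 < r) (hm : 0 < m)
    (K : Type) [Field K] [CharZero K]
    (α : Fin m → K) (hα : ∀ i, α i ≠ 0) (hinj : Function.Injective α)
    (halg : ∀ i, IsAlgebraic ℚ (α i))
    (hgen : IntermediateField.adjoin ℚ (Set.range α) = (⊤ : IntermediateField ℚ K))
    (x : ℚ) (hx : ∀ k : ℕ, x ≠ -(k + 1 : ℤ))
    (n : ℕ) (hn : 0 < n) :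
    (Matrix.det fun is jt : Fin m × Fin r =>
        phiPoly K (α is.1) x ((is.2 : ℕ) + 1)
          (Polynomial.X ^ n * PadeP K x r m n α ((jt.1 : ℕ) * r + (jt.2 : ℕ)))) =
      (-1 : K) ^ (r ^ 2 * m * n) *
        (Matrix.det fun is jt : Fin m × Fin r =>
          phiPoly K (α is.1) x ((is.2 : ℕ) + 1)
            (Polynomial.X ^ n * PadeA K r m n α ((jt.1 : ℕ) * r + (jt.2 : ℕ)))) := by
  have hx' (k : ℕ) : (k : ℚ) + x + 1 ≠ 0 := fun h => hx k (by push_cast; linarith)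
  let t : Matrix (Fin r) (Fin r) K := Matrix.of fun s j =>
    if (j : ℕ) ≤ s then algebraMap ℚ K ((weightPoly r n).coeff (s - j)) else 0
  have ht : t.det = (-1) ^ (n * r * r) := by
    rw [Matrix.det_of_isLowerTriangular t fun i j hij => if_neg (not_le.2 hij)]
    simp [t, coeff_zero_weightPoly, pow_mul]
  have hdet := Matrix.det_kronecker (1 : Matrix (Fin m) (Fin m) K) t
  rw [Matrix.det_one, one_pow, one_mul, ht, Fintype.card_fin, ← pow_mul,
    show n * r * r * m = r ^ 2 * m * n by ring] at hdet
  rw [← hdet]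
  refine Eq.trans (congrArg Matrix.det ?_) (Matrix.det_mul _ _)
  ext ⟨i, s⟩ jt
  refine Eq.trans ?_ Matrix.mul_apply.symm
  rw [Fintype.sum_prod_type, Finset.sum_eq_single i
    (fun b _ hb => Finset.sum_eq_zero fun j _ => by simp [Matrix.one_apply_ne hb.symm])
    (by simp)]
  simp only [Matrix.kroneckerMap_apply, Matrix.one_apply_eq, one_mul, t, Matrix.of_apply]
  rw [Fin.sum_univ_eq_sum_range (fun j : ℕ =>
    (if j ≤ (s : ℕ) then algebraMap ℚ K ((weightPoly r n).coeff (s - j)) else 0) *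
      phiPoly K (α i) x ((j : ℤ) + 1) (X ^ n * PadeA K r m n α ((jt.1 : ℕ) * r + (jt.2 : ℕ)))) r,
    ← Finset.sum_subset (Finset.range_subset_range.2 s.isLt)
      fun j _ hj => by rw [if_neg (by simpa using hj), zero_mul]]
  have h := phiPoly_PadeP hx' hr hn α ((jt.1 : ℕ) * r + (jt.2 : ℕ)) i (Nat.succ_pos (s : ℕ))
  rw [← Finset.sum_range_reflect, Nat.cast_succ] at h
  refine h.trans (Finset.sum_congr rfl fun j hj => ?_)
  have hj' : j ≤ (s : ℕ) := Nat.lt_succ_iff.1 (Finset.mem_range.1 hj)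
  rw [if_pos hj', show (s : ℕ).succ - 1 - j = s - j by omega,
    show (s : ℕ).succ - (s - j) = j + 1 by omega, Nat.cast_succ]
end
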